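/- Let 𝓗 be a hypergraph on a finite vertex set V and let p ∈ [0,1]. Write μ := μ_p(𝓗) and Δ := Δ_p(𝓗), and set Λ := min{μ, μ²/Δ} (with Λ := μ when Δ = 0). Then Pr(ν(𝓗[V_p]) ≤ Λ/1000) ≤ exp(−Λ/10). -/

import Mathlib

open MeasureTheory

noncomputable def bern (p : ℝ) : Measure Bool :=
  (ENNReal.ofReal p) • Measure.dirac true + (ENNReal.ofReal (1 - p)) • Measure.dirac false

/-- The product Bernoulli measure on subsets of `V` (encoded as indicator functions):
the `p`-random subset `V_p`. -/
noncomputable def pBern (V : Type*) [Fintype V] (p : ℝ) : Measure (V → Bool) :=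
  Measure.pi fun _ => bern p

/-- `μ_p(𝓗) = Σ_{A ∈ 𝓗} p^{|A|}`. -/
noncomputable def muP {V : Type*} (p : ℝ) (H : Finset (Finset V)) : ℝ :=
  ∑ A ∈ H, p ^ A.card

/-- `Δ_p(𝓗) = Σ p^{|A ∪ B|}` over unordered pairs of distinct intersecting hyperedges. -/
noncomputable def deltaP {V : Type*} [DecidableEq V] (p : ℝ) (H : Finset (Finset V)) : ℝ :=
  (∑ A ∈ H, ∑ B ∈ H, if A ≠ B ∧ ¬ Disjoint A B then p ^ (A ∪ B).card else 0) / 2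

/-- The matching number `ν(𝓗)`: the largest size of a collection of pairwise disjoint
hyperedges. -/
noncomputable def matchNum {V : Type*} (H : Finset (Finset V)) : ℕ :=
  sSup {k | ∃ M ⊆ H, (↑M : Set (Finset V)).Pairwise (fun A B => Disjoint A B) ∧ M.card = k}

/-- The subhypergraph `𝓗[W]` induced by the set encoded by `ω`. -/
def inducedBy {V : Type*} (H : Finset (Finset V)) (ω : V → Bool) : Finset (Finset V) :=
  H.filter fun A => ∀ v ∈ A, ω v = true

/-- The weight of `W` as the outcome of a `p`-random subset of `α`. -/
noncomputable def bernWeight {α : Type*} [Fintype α] [DecidableEq α] (p : ℝ) (W : Finset α) : ℝ :=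
  ∏ x, if x ∈ W then p else 1 - p

/-- The expectation of `f` evaluated at a `p`-random subset of `α`. -/
noncomputable def bernExp {α : Type*} [Fintype α] [DecidableEq α] (p : ℝ) (f : Finset α → ℝ) : ℝ :=
  ∑ W, bernWeight p W * f W

/-- The contribution of the ordered pair `(A, B)` to `deltaP`. -/
noncomputable def pairWeight {V : Type*} [DecidableEq V] (p : ℝ) (A B : Finset V) : ℝ :=
  if A ≠ B ∧ ¬ Disjoint A B then p ^ (A ∪ B).card else 0

/-- The indicator of the event that `W` contains no hyperedge of `G`. -/
noncomputable def avoidInd {V : Type*} [DecidableEq V] (G : Finset (Finset V)) (W : Finset V) : ℝ :=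
  if ∀ B ∈ G, ¬ B ⊆ W then 1 else 0

section BernExp

variable {α : Type*} [Fintype α] [DecidableEq α] {p : ℝ}

lemma bernWeight_nonneg (hp : p ∈ Set.Icc (0 : ℝ) 1) (W : Finset α) : 0 ≤ bernWeight p W :=
  Finset.prod_nonneg fun x _ => by split_ifs <;> linarith [hp.1, hp.2]

lemma bernExp_mono (hp : p ∈ Set.Icc (0 : ℝ) 1) {f g : Finset α → ℝ} (h : ∀ W, f W ≤ g W) :
    bernExp p f ≤ bernExp p g :=
  Finset.sum_le_sum fun W _ => mul_le_mul_of_nonneg_left (h W) (bernWeight_nonneg hp W)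

lemma bernExp_nonneg (hp : p ∈ Set.Icc (0 : ℝ) 1) {f : Finset α → ℝ} (h : ∀ W, 0 ≤ f W) :
    0 ≤ bernExp p f :=
  Finset.sum_nonneg fun W _ => mul_nonneg (bernWeight_nonneg hp W) (h W)

lemma bernExp_sub (f g : Finset α → ℝ) :
    bernExp p (fun W => f W - g W) = bernExp p f - bernExp p g := by
  simp [bernExp, mul_sub]

lemma bernExp_const_mul (c : ℝ) (f : Finset α → ℝ) :
    bernExp p (fun W => c * f W) = c * bernExp p f := by
  simp only [bernExp, Finset.mul_sum]
  exact Finset.sum_congr rfl fun W _ => by ring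

lemma bernExp_sum {ι : Type*} (s : Finset ι) (f : ι → Finset α → ℝ) :
    bernExp p (fun W => ∑ i ∈ s, f i W) = ∑ i ∈ s, bernExp p (f i) := by
  simp only [bernExp, Finset.mul_sum]
  exact Finset.sum_comm

lemma bernExp_const (c : ℝ) : bernExp p (fun _ : Finset α => c) = c := by
  have h := Finset.prod_add (fun _ : α => p) (fun _ => 1 - p) Finset.univ
  simp only [add_sub_cancel, Finset.prod_const_one, Finset.powerset_univ] at h
  rw [bernExp, ← Finset.sum_mul]
  have : ∑ W : Finset α, bernWeight p W = 1 := by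
    rw [h]
    refine Finset.sum_congr rfl fun W _ => ?_
    rw [bernWeight, Finset.prod_ite]
    congr 1
    · exact Finset.prod_congr (by ext; simp) fun _ _ => rfl
    · exact Finset.prod_congr (by ext; simp) fun _ _ => rfl
  rw [this, one_mul]

lemma bernExp_split (v : α) (f : Finset α → ℝ) :
    bernExp p f = ∑ t ∈ (Finset.univ.erase v).powerset,
      (∏ x ∈ Finset.univ.erase v, if x ∈ t then p else 1 - p) *
        ((1 - p) * f t + p * f (insert v t)) := by
  have hu : (Finset.univ : Finset (Finset α)) = (insert v (Finset.univ.erase v)).powerset := by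
    rw [Finset.insert_erase (Finset.mem_univ v), Finset.powerset_univ]
  rw [bernExp, hu, Finset.sum_powerset_insert (Finset.notMem_erase v _), ← Finset.sum_add_distrib]
  refine Finset.sum_congr rfl fun t ht => ?_
  have hv : v ∉ t := fun h => by simpa using Finset.mem_powerset.1 ht h
  have h1 : bernWeight p t =
      (1 - p) * ∏ x ∈ Finset.univ.erase v, if x ∈ t then p else 1 - p := by
    rw [bernWeight, ← Finset.mul_prod_erase _ _ (Finset.mem_univ v), if_neg hv]
  have h2 : bernWeight p (insert v t) =
      p * ∏ x ∈ Finset.univ.erase v, if x ∈ t then p else 1 - p := by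
    rw [bernWeight, ← Finset.mul_prod_erase _ _ (Finset.mem_univ v),
      if_pos (Finset.mem_insert_self _ _)]
    congr 1
    refine Finset.prod_congr rfl fun x hx => ?_
    simp [Finset.mem_insert, Finset.ne_of_mem_erase hx]
  rw [h1, h2]
  ring

lemma bernExp_mem_mul (v : α) (f : Finset α → ℝ) (hf : ∀ W, f (insert v W) = f W) :
    bernExp p (fun W => if v ∈ W then f W else 0) = p * bernExp p f := by
  rw [bernExp_split v, bernExp_split v, Finset.mul_sum]
  refine Finset.sum_congr rfl fun t ht => ?_
  have hv : v ∉ t := fun h => by simpa using Finset.mem_powerset.1 ht h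
  simp only [hv, if_false, Finset.mem_insert_self, if_true, hf]
  ring

lemma bernExp_subset_mul (U : Finset α) (f : Finset α → ℝ)
    (hf : ∀ v ∈ U, ∀ W, f (insert v W) = f W) :
    bernExp p (fun W => if U ⊆ W then f W else 0) = p ^ U.card * bernExp p f := by
  induction U using Finset.induction_on with
  | empty => simp
  | insert v U hv ih =>
    have h1 : (fun W => if insert v U ⊆ W then f W else 0) =
        fun W => if v ∈ W then (if U ⊆ W then f W else 0) else 0 := by
      funext W
      by_cases h : v ∈ W <;> simp [Finset.insert_subset_iff, h]
    rw [h1, bernExp_mem_mul, ih fun u hu => hf u (Finset.mem_insert_of_mem hu),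
      Finset.card_insert_of_notMem hv]
    · ring
    · intro W
      simp only [Finset.subset_insert_iff_of_notMem hv, hf v (Finset.mem_insert_self _ _)]

lemma bernExp_subset (U : Finset α) :
    bernExp p (fun W => if U ⊆ W then 1 else 0) = p ^ U.card := by
  rw [bernExp_subset_mul U (fun _ => 1) fun _ _ _ => rfl, bernExp_const, mul_one]

/-- Harris' inequality for nonnegative monotone functions of a random subset. -/
lemma bernExp_mul_le (hp : p ∈ Set.Icc (0 : ℝ) 1) {f g : Finset α → ℝ} (hf0 : 0 ≤ f)
    (hg0 : 0 ≤ g) (hf : Monotone f) (hg : Monotone g) :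
    bernExp p f * bernExp p g ≤ bernExp p fun W => f W * g W := by
  have h := fkg (μ := bernWeight p) (f := f) (g := g) (fun W => bernWeight_nonneg hp W) hf0 hg0
    hf hg fun a b => by
    simp only [bernWeight]
    rw [← Finset.prod_mul_distrib,
      ← Finset.prod_mul_distrib]
    refine (Finset.prod_congr rfl fun x _ => ?_).le
    by_cases ha : x ∈ a <;> by_cases hb : x ∈ b <;> simp [ha, hb, mul_comm]
  have h1 := bernExp_const (α := α) (p := p) 1
  simp only [bernExp, mul_one] at h1 ⊢
  rwa [h1, one_mul] at h

end BernExp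

lemma muP_nonneg {V : Type*} {p : ℝ} (hp : 0 ≤ p) (H : Finset (Finset V)) : 0 ≤ muP p H :=
  Finset.sum_nonneg fun _ _ => pow_nonneg hp _

section Hypergraph

variable {V : Type*} [DecidableEq V] {p : ℝ}

lemma pairWeight_comm (A B : Finset V) : pairWeight p A B = pairWeight p B A := by
  simp only [pairWeight, ne_comm (a := A), disjoint_comm (a := A), Finset.union_comm A]

lemma pairWeight_self (A : Finset V) : pairWeight p A A = 0 := by
  simp [pairWeight]

lemma pairWeight_nonneg (hp : 0 ≤ p) (A B : Finset V) : 0 ≤ pairWeight p A B := by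
  unfold pairWeight
  split_ifs <;> positivity

lemma deltaP_eq (H : Finset (Finset V)) :
    deltaP p H = (∑ A ∈ H, ∑ B ∈ H, pairWeight p A B) / 2 := rfl

lemma deltaP_nonneg (hp : 0 ≤ p) (H : Finset (Finset V)) : 0 ≤ deltaP p H :=
  div_nonneg (Finset.sum_nonneg fun _ _ => Finset.sum_nonneg fun _ _ =>
    pairWeight_nonneg hp _ _) zero_le_two

lemma deltaP_insert {A : Finset V} {G : Finset (Finset V)} (hA : A ∉ G) :
    deltaP p (insert A G) = deltaP p G + ∑ B ∈ G, pairWeight p A B := by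
  simp only [deltaP_eq, Finset.sum_insert hA, pairWeight_self, Finset.sum_add_distrib,
    fun B => pairWeight_comm (p := p) B A]
  ring

lemma deltaP_mono (hp : 0 ≤ p) {G S : Finset (Finset V)} (h : G ⊆ S) :
    deltaP p G ≤ deltaP p S := by
  rw [deltaP_eq, deltaP_eq]
  refine div_le_div_of_nonneg_right ?_ zero_le_two
  calc ∑ A ∈ G, ∑ B ∈ G, pairWeight p A B ≤ ∑ A ∈ G, ∑ B ∈ S, pairWeight p A B :=
        Finset.sum_le_sum fun A _ => Finset.sum_le_sum_of_subset_of_nonneg h fun _ _ _ =>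
          pairWeight_nonneg hp _ _
    _ ≤ _ := Finset.sum_le_sum_of_subset_of_nonneg h fun _ _ _ =>
          Finset.sum_nonneg fun _ _ => pairWeight_nonneg hp _ _

lemma avoidInd_nonneg (G : Finset (Finset V)) (W : Finset V) : 0 ≤ avoidInd G W := by
  unfold avoidInd
  split_ifs <;> norm_num

lemma avoidInd_le_one (G : Finset (Finset V)) (W : Finset V) : avoidInd G W ≤ 1 := by
  unfold avoidInd
  split_ifs <;> norm_num

lemma avoidInd_anti (G : Finset (Finset V)) : Antitone (avoidInd G) := by
  intro W W' h
  unfold avoidInd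
  split_ifs with h1 h2
  · rfl
  · exact absurd (fun B hB hs => h1 B hB (hs.trans h)) h2
  · norm_num
  · rfl

lemma avoidInd_insert_left (A : Finset V) (G : Finset (Finset V)) (W : Finset V) :
    avoidInd (insert A G) W = avoidInd G W - if A ⊆ W then avoidInd G W else 0 := by
  unfold avoidInd
  by_cases h : A ⊆ W <;> simp [h]

lemma avoidInd_anti_left {G S : Finset (Finset V)} (h : G ⊆ S) (W : Finset V) :
    avoidInd S W ≤ avoidInd G W := by
  unfold avoidInd
  split_ifs with h1 h2
  · rfl
  · exact absurd (fun B hB => h1 B (h hB)) h2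
  · norm_num
  · rfl

lemma avoidInd_insert_right {G : Finset (Finset V)} {v : V} (hv : ∀ B ∈ G, v ∉ B)
    (W : Finset V) : avoidInd G (insert v W) = avoidInd G W := by
  unfold avoidInd
  congr 1
  refine propext (forall₂_congr fun B hB => ?_)
  rw [Finset.subset_insert_iff_of_notMem (hv B hB)]

variable [Fintype V]

lemma bernExp_subset_avoidInd_le (hp : p ∈ Set.Icc (0 : ℝ) 1) (U : Finset V)
    (G : Finset (Finset V)) :
    bernExp p (fun W => if U ⊆ W then avoidInd G W else 0) ≤
      p ^ U.card * bernExp p (avoidInd G) := by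
  have h := bernExp_mul_le hp (f := fun W => if U ⊆ W then 1 else 0)
    (g := fun W => 1 - avoidInd G W) (fun W => by simp only [Pi.zero_apply]; split_ifs <;> norm_num)
    (fun W => sub_nonneg.2 (avoidInd_le_one G W))
    (fun W W' h => by
      dsimp only
      split_ifs with h1 h2
      · rfl
      · exact absurd (h1.trans h) h2
      · norm_num
      · rfl)
    (fun W W' h => sub_le_sub_left (avoidInd_anti G h) 1)
  rw [bernExp_subset, bernExp_sub, bernExp_const] at h
  have h2 : (fun W => (if U ⊆ W then 1 else 0) * (1 - avoidInd G W)) =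
      fun W => (if U ⊆ W then 1 else 0) - if U ⊆ W then avoidInd G W else 0 := by
    funext W
    split_ifs <;> ring
  rw [h2, bernExp_sub, bernExp_subset] at h
  linarith

/-- Janson's inequality for the probability that no hyperedge is present. -/
lemma bernExp_avoidInd_le (hp : p ∈ Set.Icc (0 : ℝ) 1) (G : Finset (Finset V)) :
    bernExp p (avoidInd G) ≤ Real.exp (-muP p G + deltaP p G) := by
  induction G using Finset.induction_on with
  | empty =>
    have : avoidInd (∅ : Finset (Finset V)) = fun _ => 1 := by funext; simp [avoidInd]
    rw [this, bernExp_const]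
    simp [muP, deltaP]
  | insert A G hA ih =>
    set c := p ^ A.card - ∑ B ∈ G, pairWeight p A B with hc
    have h0 : 0 ≤ bernExp p (avoidInd G) := bernExp_nonneg hp (avoidInd_nonneg G)
    have key : c * bernExp p (avoidInd G) ≤
        bernExp p (fun W => if A ⊆ W then avoidInd G W else 0) := by
      rcases le_total c 0 with hc0 | hc0
      · exact (mul_nonpos_of_nonpos_of_nonneg hc0 h0).trans
          (bernExp_nonneg hp fun W => by split_ifs <;> simp [avoidInd_nonneg])
      set G₀ := G.filter fun B => Disjoint A B with hG₀
      set G₁ := G.filter fun B => ¬ Disjoint A B with hG₁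
      have hpt : ∀ W, (if A ⊆ W then avoidInd G₀ W else 0) -
          ∑ B ∈ G₁, (if A ∪ B ⊆ W then avoidInd G₀ W else 0) ≤
          if A ⊆ W then avoidInd G W else 0 := by
        intro W
        have hs : ∀ B ∈ G₁, (0 : ℝ) ≤ if A ∪ B ⊆ W then avoidInd G₀ W else 0 := fun B _ => by
          split_ifs <;> simp [avoidInd_nonneg]
        by_cases hAW : A ⊆ W
        · simp only [hAW, if_true]
          by_cases hex : ∃ B ∈ G₁, B ⊆ W
          · obtain ⟨B, hB, hBW⟩ := hex
            have := Finset.single_le_sum hs hB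
            rw [if_pos (Finset.union_subset hAW hBW)] at this
            linarith [avoidInd_nonneg G W]
          · push Not at hex
            have : avoidInd G₀ W ≤ avoidInd G W := by
              unfold avoidInd
              split_ifs with h1 h2
              · rfl
              · refine absurd (fun B hB => ?_) h2
                by_cases hd : Disjoint A B
                · exact h1 B (Finset.mem_filter.2 ⟨hB, hd⟩)
                · exact hex B (Finset.mem_filter.2 ⟨hB, hd⟩)
              · norm_num
              · rfl
            linarith [Finset.sum_nonneg hs]
        · simp only [hAW, if_false]
          linarith [Finset.sum_nonneg hs]
      have hE := bernExp_mono hp hpt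
      rw [bernExp_sub, bernExp_sum, bernExp_subset_mul A (avoidInd G₀) fun v hv W =>
        avoidInd_insert_right (fun B hB =>
          Finset.disjoint_left.1 (Finset.mem_filter.1 hB).2 hv) W] at hE
      have hsum : ∑ B ∈ G₁, bernExp p (fun W => if A ∪ B ⊆ W then avoidInd G₀ W else 0) ≤
          (∑ B ∈ G, pairWeight p A B) * bernExp p (avoidInd G₀) := by
        have h3 : ∑ B ∈ G, pairWeight p A B = ∑ B ∈ G₁, p ^ (A ∪ B).card := by
          rw [hG₁, Finset.sum_filter]
          refine Finset.sum_congr rfl fun B hB => ?_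
          have : A ≠ B := fun h => hA (h ▸ hB)
          simp [pairWeight, this]
        rw [h3, Finset.sum_mul]
        exact Finset.sum_le_sum fun B _ => bernExp_subset_avoidInd_le hp _ _
      calc c * bernExp p (avoidInd G) ≤ c * bernExp p (avoidInd G₀) :=
            mul_le_mul_of_nonneg_left
              (bernExp_mono hp (avoidInd_anti_left (Finset.filter_subset _ _))) hc0
        _ ≤ _ := by rw [hc]; linarith
    have h1 : bernExp p (avoidInd (insert A G)) = bernExp p (avoidInd G) -
        bernExp p (fun W => if A ⊆ W then avoidInd G W else 0) := by
      rw [← bernExp_sub]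
      congr 1
      funext W
      exact avoidInd_insert_left A G W
    have h2 : -muP p (insert A G) + deltaP p (insert A G) = -c + (-muP p G + deltaP p G) := by
      rw [deltaP_insert hA, muP, Finset.sum_insert hA, hc, muP]
      ring
    rw [h1, h2, Real.exp_add]
    calc _ ≤ (1 - c) * bernExp p (avoidInd G) := by linarith
      _ ≤ Real.exp (-c) * bernExp p (avoidInd G) :=
          mul_le_mul_of_nonneg_right (by linarith [Real.add_one_le_exp (-c)]) h0
      _ ≤ _ := mul_le_mul_of_nonneg_left ih (Real.exp_nonneg _)

/-- Comparison of the maximum of `muP - deltaP` over subhypergraphs with its average over a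
`q`-random subhypergraph. -/
lemma le_of_forall_subset_muP_sub_deltaP_le {H : Finset (Finset V)} {q F : ℝ}
    (hq : q ∈ Set.Icc (0 : ℝ) 1) (hF : ∀ T ⊆ H, muP p T - deltaP p T ≤ F) :
    q * muP p H - q ^ 2 * deltaP p H ≤ F := by
  have hE := bernExp_mono hq (f := fun T => muP p (H ∩ T) - deltaP p (H ∩ T))
    (g := fun _ => F) fun T => hF _ Finset.inter_subset_left
  rw [bernExp_const, bernExp_sub] at hE
  have h1 : bernExp q (fun T => muP p (H ∩ T)) = q * muP p H := by
    have : (fun T => muP p (H ∩ T)) =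
        fun T => ∑ A ∈ H, p ^ A.card * if ({A} : Finset (Finset V)) ⊆ T then 1 else 0 := by
      funext T
      simp [muP]
    rw [this, bernExp_sum, muP, Finset.mul_sum]
    refine Finset.sum_congr rfl fun A _ => ?_
    rw [bernExp_const_mul, bernExp_subset, Finset.card_singleton, pow_one, mul_comm]
  have h2 : bernExp q (fun T => deltaP p (H ∩ T)) = q ^ 2 * deltaP p H := by
    have : (fun T => deltaP p (H ∩ T)) = fun T => ∑ A ∈ H, ∑ B ∈ H,
        pairWeight p A B / 2 * if ({A, B} : Finset (Finset V)) ⊆ T then 1 else 0 := by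
      funext T
      rw [deltaP_eq, Finset.sum_div, ← Finset.filter_mem_eq_inter, Finset.sum_filter]
      refine Finset.sum_congr rfl fun A _ => ?_
      by_cases hA : A ∈ T
      · rw [if_pos hA, Finset.sum_div, Finset.sum_filter]
        refine Finset.sum_congr rfl fun B _ => ?_
        simp [Finset.insert_subset_iff, hA]
      · simp [Finset.insert_subset_iff, hA]
    rw [this, bernExp_sum, deltaP_eq, Finset.sum_div, Finset.mul_sum]
    refine Finset.sum_congr rfl fun A _ => ?_
    rw [bernExp_sum, Finset.sum_div, Finset.mul_sum]
    refine Finset.sum_congr rfl fun B _ => ?_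
    rw [bernExp_const_mul, bernExp_subset]
    by_cases hAB : A = B
    · simp [hAB, pairWeight_self]
    · rw [Finset.card_pair hAB, mul_comm]
  rwa [h1, h2] at hE

end Hypergraph

section Matching

variable {V : Type*} {p : ℝ}

lemma mem_inducedBy {H : Finset (Finset V)} {ω : V → Bool} {A : Finset V} :
    A ∈ inducedBy H ω ↔ A ∈ H ∧ ∀ v ∈ A, ω v = true :=
  Finset.mem_filter

lemma card_le_matchNum {M G : Finset (Finset V)} (hM : M ⊆ G)
    (hd : (↑M : Set (Finset V)).Pairwise fun A B => Disjoint A B) : M.card ≤ matchNum G := by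
  refine le_csSup ⟨G.card, ?_⟩ ⟨M, hM, hd, rfl⟩
  rintro _ ⟨N, hN, -, rfl⟩
  exact Finset.card_le_card hN

open Classical in
/-- The collections of pairwise disjoint hyperedges of `G`. -/
noncomputable def matchings (G : Finset (Finset V)) : Finset (Finset (Finset V)) :=
  G.powerset.filter fun M => (↑M : Set (Finset V)).Pairwise fun A B => Disjoint A B

lemma mem_matchings {M G : Finset (Finset V)} : M ∈ matchings G ↔
    M ⊆ G ∧ (↑M : Set (Finset V)).Pairwise fun A B => Disjoint A B := by
  classical
  rw [matchings, Finset.mem_filter, Finset.mem_powerset]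

lemma matchings_subset_powerset (G : Finset (Finset V)) : matchings G ⊆ G.powerset := fun _ hM =>
  Finset.mem_powerset.2 (mem_matchings.1 hM).1

lemma exists_maximal_matching [DecidableEq V] (G : Finset (Finset V)) :
    ∃ M ⊆ G, (↑M : Set (Finset V)).Pairwise (fun A B => Disjoint A B) ∧
      ∀ B ∈ G, B ∉ M → ∃ A ∈ M, ¬ Disjoint A B := by
  obtain ⟨M, hM, hmax⟩ := Finset.exists_max_image (matchings G) Finset.card
    ⟨∅, mem_matchings.2 (by simp)⟩
  rw [mem_matchings] at hM
  refine ⟨M, hM.1, hM.2, fun B hB hBM => ?_⟩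
  by_contra! hcon
  have h := hmax (insert B M) (by
    rw [mem_matchings, Finset.insert_subset_iff, Finset.coe_insert]
    exact ⟨⟨hB, hM.1⟩, hM.2.insert fun A hA _ => ⟨(hcon A hA).symm, hcon A hA⟩⟩)
  rw [Finset.card_insert_of_notMem hBM] at h
  omega

variable [DecidableEq V]

/-- The hyperedges of `S` that could be added to the matching `M`. -/
def extending (S M : Finset (Finset V)) : Finset (Finset V) :=
  S.filter fun B => B ∉ M ∧ ∀ A ∈ M, Disjoint A B

lemma mem_extending {S M : Finset (Finset V)} {B : Finset V} :
    B ∈ extending S M ↔ B ∈ S ∧ B ∉ M ∧ ∀ A ∈ M, Disjoint A B :=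
  Finset.mem_filter

lemma extending_subset (S M : Finset (Finset V)) : extending S M ⊆ S :=
  Finset.filter_subset _ _

/-- A maximiser of `muP - deltaP` among subhypergraphs has bounded weighted degrees. -/
lemma exists_subset_maximizing_muP_sub_deltaP (H : Finset (Finset V)) :
    ∃ S ⊆ H, (∀ T ⊆ H, muP p T - deltaP p T ≤ muP p S - deltaP p S) ∧
      ∀ A ∈ S, ∑ B ∈ S, pairWeight p A B ≤ p ^ A.card := by
  obtain ⟨S, hS, hmax⟩ := Finset.exists_max_image H.powerset
    (fun T => muP p T - deltaP p T) ⟨∅, by simp⟩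
  rw [Finset.mem_powerset] at hS
  refine ⟨S, hS, fun T hT => hmax T (Finset.mem_powerset.2 hT), fun A hA => ?_⟩
  have h := hmax (S.erase A) (Finset.mem_powerset.2 ((Finset.erase_subset _ _).trans hS))
  have h1 := deltaP_insert (p := p) (Finset.notMem_erase A S)
  have h2 := Finset.add_sum_erase S (fun B => pairWeight p A B) hA
  have h3 := Finset.add_sum_erase S (fun B => p ^ B.card) hA
  rw [Finset.insert_erase hA] at h1
  simp only [pairWeight_self, zero_add] at h2
  simp only [muP] at h
  linarith

lemma two_mul_deltaP_le_muP {S : Finset (Finset V)}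
    (hS : ∀ A ∈ S, ∑ B ∈ S, pairWeight p A B ≤ p ^ A.card) : 2 * deltaP p S ≤ muP p S := by
  have := Finset.sum_le_sum hS
  rw [deltaP_eq, muP]
  linarith

lemma sum_neighbours_le_one (hp : p ∈ Set.Icc (0 : ℝ) 1) {S : Finset (Finset V)} {A : Finset V}
    (hA : ∑ B ∈ S, pairWeight p A B ≤ p ^ A.card) (hpos : 0 < p ^ A.card) :
    ∑ B ∈ S.filter (fun B => A ≠ B ∧ ¬ Disjoint A B), p ^ B.card ≤ 1 := by
  refine le_of_mul_le_mul_left ?_ hpos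
  rw [mul_one, Finset.mul_sum, Finset.sum_filter]
  refine le_trans (Finset.sum_le_sum fun B _ => ?_) hA
  unfold pairWeight
  split_ifs
  · rw [← pow_add]
    exact pow_le_pow_of_le_one hp.1 hp.2 (Finset.card_union_le A B)
  · rfl

lemma muP_le_muP_extending_add (hp : p ∈ Set.Icc (0 : ℝ) 1) {S M : Finset (Finset V)}
    (hS : ∀ A ∈ S, ∑ B ∈ S, pairWeight p A B ≤ p ^ A.card) (hM : M ⊆ S)
    (hpos : ∀ A ∈ M, 0 < p ^ A.card) :
    muP p S ≤ muP p (extending S M) + 2 * M.card := by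
  set N : Finset V → Finset (Finset V) :=
    fun A => insert A (S.filter fun B => A ≠ B ∧ ¬ Disjoint A B) with hN
  have hcover : S ⊆ extending S M ∪ M.biUnion N := by
    intro B hB
    by_contra h
    simp only [mem_extending, hN, Finset.mem_union, Finset.mem_filter, Finset.mem_biUnion,
      Finset.mem_insert, not_or, not_exists, not_and] at h
    refine h.1 hB (fun hBM => (h.2 B hBM).1 rfl) fun A hA => ?_
    by_contra hAB
    exact (h.2 A hA).2 hB (Ne.symm (h.2 A hA).1) hAB
  have h0 : ∀ B : Finset V, 0 ≤ p ^ B.card := fun B => pow_nonneg hp.1 _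
  have hdeg : ∀ A ∈ M, ∑ B ∈ N A, p ^ B.card ≤ 2 := fun A hA => by
    rw [hN, Finset.sum_insert (by simp)]
    linarith [sum_neighbours_le_one hp (hS A (hM hA)) (hpos A hA),
      pow_le_one₀ hp.1 hp.2 (n := A.card)]
  have hbi : ∑ B ∈ M.biUnion N, p ^ B.card ≤ ∑ A ∈ M, ∑ B ∈ N A, p ^ B.card := by
    clear hcover hdeg hM hpos
    induction M using Finset.induction_on with
    | empty => simp
    | insert A M hA ih =>
      rw [Finset.biUnion_insert, Finset.sum_insert hA]
      have h := Finset.sum_union_inter (s₁ := N A) (s₂ := M.biUnion N) (f := fun B => p ^ B.card)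
      linarith [Finset.sum_nonneg fun B (_ : B ∈ N A ∩ M.biUnion N) => h0 B]
  calc muP p S ≤ ∑ B ∈ extending S M ∪ M.biUnion N, p ^ B.card :=
        Finset.sum_le_sum_of_subset_of_nonneg hcover fun B _ _ => h0 B
    _ ≤ muP p (extending S M) + ∑ B ∈ M.biUnion N, p ^ B.card := by
        rw [muP, ← Finset.sum_union_inter]
        linarith [Finset.sum_nonneg fun B (_ : B ∈ extending S M ∩ M.biUnion N) => h0 B]
    _ ≤ muP p (extending S M) + ∑ A ∈ M, (2 : ℝ) := by
        linarith [Finset.sum_le_sum hdeg]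
    _ = _ := by simp [mul_comm]

variable [Fintype V]

lemma bernExp_maximal_matching_le (hp : p ∈ Set.Icc (0 : ℝ) 1) {S M : Finset (Finset V)}
    (hS : ∀ A ∈ S, ∑ B ∈ S, pairWeight p A B ≤ p ^ A.card) (hM : M ⊆ S)
    (hd : (↑M : Set (Finset V)).Pairwise fun A B => Disjoint A B) :
    bernExp p (fun W => if M.biUnion id ⊆ W then avoidInd (extending S M) W else 0) ≤
      Real.exp (-muP p S + deltaP p S) * ∏ A ∈ M, (p ^ A.card * Real.exp 2) := by
  refine (bernExp_subset_avoidInd_le hp _ _).trans ?_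
  rw [Finset.card_biUnion (t := id) hd, ← Finset.prod_pow_eq_pow_sum, Finset.prod_mul_distrib,
    Finset.prod_const, ← Real.exp_nat_mul]
  simp only [id]
  by_cases hpos : ∀ A ∈ M, 0 < p ^ A.card
  · have h1 := muP_le_muP_extending_add hp hS hM hpos
    have h2 := deltaP_mono hp.1 (extending_subset S M)
    rw [mul_left_comm, ← Real.exp_add]
    refine mul_le_mul_of_nonneg_left ?_ (Finset.prod_nonneg fun A hA => (hpos A hA).le)
    exact (bernExp_avoidInd_le hp _).trans (Real.exp_le_exp.2 (by linarith))
  · push Not at hpos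
    obtain ⟨A, hA, hA0⟩ := hpos
    rw [Finset.prod_eq_zero hA (le_antisymm hA0 (pow_nonneg hp.1 _))]
    simp

lemma pBern_le_bernExp (hp : p ∈ Set.Icc (0 : ℝ) 1) (T : Set (V → Bool)) {g : Finset V → ℝ}
    (hg0 : ∀ W, 0 ≤ g W) (hg : ∀ W : Finset V, (fun v => decide (v ∈ W)) ∈ T → 1 ≤ g W) :
    pBern V p T ≤ ENNReal.ofReal (bernExp p g) := by
  classical
  have : IsFiniteMeasure (bern p) := ⟨by simp [bern, ENNReal.ofReal_lt_top]⟩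
  have hsing : ∀ ω : V → Bool, pBern V p {ω} =
      ENNReal.ofReal (bernWeight p (Finset.univ.filter fun v => ω v = true)) := by
    intro ω
    rw [pBern, Measure.pi_singleton, bernWeight, ENNReal.ofReal_prod_of_nonneg
      fun x _ => by split_ifs <;> linarith [hp.1, hp.2]]
    refine Finset.prod_congr rfl fun v _ => ?_
    cases h : ω v <;> simp [bern, h]
  have hT : T = ↑(Finset.univ.filter fun ω => ω ∈ T) := by ext; simp
  rw [hT, ← sum_measure_singleton, bernExp, Finset.sum_congr rfl fun ω _ => hsing ω,
    ← ENNReal.ofReal_sum_of_nonneg fun _ _ => bernWeight_nonneg hp _]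
  refine ENNReal.ofReal_le_ofReal ?_
  calc _ = ∑ W ∈ Finset.univ.filter (fun W : Finset V => (fun v => decide (v ∈ W)) ∈ T),
        bernWeight p W := by
        refine Finset.sum_nbij' (fun ω => Finset.univ.filter fun v => ω v = true)
          (fun W v => decide (v ∈ W)) ?_ ?_ ?_ ?_ ?_ <;> simp
    _ ≤ ∑ W ∈ Finset.univ.filter (fun W : Finset V => (fun v => decide (v ∈ W)) ∈ T),
        bernWeight p W * g W := Finset.sum_le_sum fun W hW =>
          le_mul_of_one_le_right (bernWeight_nonneg hp W) (hg W (Finset.mem_filter.1 hW).2)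
    _ ≤ _ := Finset.sum_le_sum_of_subset_of_nonneg (Finset.subset_univ _) fun W _ _ =>
          mul_nonneg (bernWeight_nonneg hp W) (hg0 W)

lemma pBern_matchNum_le (hp : p ∈ Set.Icc (0 : ℝ) 1) {H S : Finset (Finset V)} (hSH : S ⊆ H)
    (hS : ∀ A ∈ S, ∑ B ∈ S, pairWeight p A B ≤ p ^ A.card) (k : ℝ) :
    pBern V p {ω | (matchNum (inducedBy H ω) : ℝ) ≤ k} ≤
      ENNReal.ofReal (Real.exp (7 * k - muP p S + deltaP p S + Real.exp (-5) * muP p S)) := by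
  set ind : Finset (Finset V) → Finset V → ℝ :=
    fun M W => if M.biUnion id ⊆ W then avoidInd (extending S M) W else 0 with hind
  have hind0 : ∀ M W, 0 ≤ ind M W := fun M W => by
    simp only [hind]
    split_ifs <;> simp [avoidInd_nonneg]
  have hterm : ∀ M ∈ matchings S, ∀ W, 0 ≤ Real.exp (7 * k) * Real.exp (-7) ^ M.card * ind M W :=
    fun M _ W => mul_nonneg (by positivity) (hind0 M W)
  refine (pBern_le_bernExp hp _ (g := fun W => ∑ M ∈ matchings S,
    Real.exp (7 * k) * Real.exp (-7) ^ M.card * ind M W)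
    (fun W => Finset.sum_nonneg fun M hM => hterm M hM W) fun W hW => ?_).trans
    (ENNReal.ofReal_le_ofReal ?_)
  · obtain ⟨M, hM, hd, hmax⟩ := exists_maximal_matching (S.filter fun A => A ⊆ W)
    have hMm : M ∈ matchings S := mem_matchings.2 ⟨hM.trans (Finset.filter_subset _ _), hd⟩
    refine le_trans ?_ (Finset.single_le_sum (fun M hM => hterm M hM W) hMm)
    have hone : ind M W = 1 := by
      simp only [hind]
      have hU : M.biUnion id ⊆ W :=
        Finset.biUnion_subset.2 fun A hA => (Finset.mem_filter.1 (hM hA)).2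
      rw [if_pos hU, avoidInd, if_pos]
      intro B hB hBW
      obtain ⟨hBS, hBM, hdis⟩ := mem_extending.1 hB
      obtain ⟨A, hA, hAB⟩ := hmax B (Finset.mem_filter.2 ⟨hBS, hBW⟩) hBM
      exact hAB (hdis A hA)
    have hcard : (M.card : ℝ) ≤ k := by
      refine le_trans (Nat.cast_le.2 (card_le_matchNum (fun A hA => ?_) hd)) hW
      obtain ⟨hAS, hAW⟩ := Finset.mem_filter.1 (hM hA)
      exact mem_inducedBy.2 ⟨hSH hAS, fun v hv => by simpa using hAW hv⟩
    rw [hone, mul_one, ← Real.exp_nat_mul, ← Real.exp_add, Real.one_le_exp_iff]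
    linarith
  · have hM : ∀ M ∈ matchings S, Real.exp (7 * k) * Real.exp (-7) ^ M.card * bernExp p (ind M) ≤
        Real.exp (7 * k) * Real.exp (-muP p S + deltaP p S) *
          ∏ A ∈ M, (Real.exp (-5) * p ^ A.card) := by
      intro M hM
      obtain ⟨hMS, hd⟩ := mem_matchings.1 hM
      refine (mul_le_mul_of_nonneg_left (bernExp_maximal_matching_le hp hS hMS hd)
        (by positivity)).trans_eq ?_
      have h5 : Real.exp (-5) = Real.exp (-7) * Real.exp 2 := by
        rw [← Real.exp_add]
        norm_num
      simp only [h5, Finset.prod_mul_distrib, Finset.prod_const]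
      ring
    rw [bernExp_sum]
    simp only [bernExp_const_mul]
    calc _ ≤ _ := Finset.sum_le_sum hM
      _ ≤ ∑ M ∈ S.powerset, Real.exp (7 * k) * Real.exp (-muP p S + deltaP p S) *
          ∏ A ∈ M, (Real.exp (-5) * p ^ A.card) :=
        Finset.sum_le_sum_of_subset_of_nonneg (matchings_subset_powerset S) fun M _ _ =>
          mul_nonneg (by positivity) (Finset.prod_nonneg fun A _ =>
            mul_nonneg (Real.exp_nonneg _) (pow_nonneg hp.1 _))
      _ = Real.exp (7 * k) * Real.exp (-muP p S + deltaP p S) *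
          ∏ A ∈ S, (1 + Real.exp (-5) * p ^ A.card) := by
        rw [← Finset.mul_sum, Finset.prod_one_add]
      _ ≤ Real.exp (7 * k) * Real.exp (-muP p S + deltaP p S) *
          Real.exp (Real.exp (-5) * muP p S) := by
        refine mul_le_mul_of_nonneg_left ?_ (by positivity)
        rw [muP, Finset.mul_sum]
        exact Real.prod_one_add_le_exp_sum _ fun A =>
          mul_nonneg (Real.exp_nonneg _) (pow_nonneg hp.1 _)
      _ = _ := by
        rw [← Real.exp_add, ← Real.exp_add]
        congr 1
        ring

end Matching

theorem stmt4 {V : Type} [Fintype V] [DecidableEq V] (H : Finset (Finset V))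
    (p : ℝ) (hp : p ∈ Set.Icc (0 : ℝ) 1)
    (μ Δ Λ : ℝ) (hμ : μ = muP p H) (hΔ : Δ = deltaP p H)
    (hΛ : Λ = if Δ = 0 then μ else min μ (μ ^ 2 / Δ)) :
    pBern V p {ω | (matchNum (inducedBy H ω) : ℝ) ≤ Λ / 1000}
      ≤ ENNReal.ofReal (Real.exp (-(Λ / 10))) := by
  obtain ⟨S, hSH, hmax, hS⟩ := exists_subset_maximizing_muP_sub_deltaP (p := p) H
  have havg := fun q hq => le_of_forall_subset_muP_sub_deltaP_le (q := q) hq hmax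
  rw [← hμ, ← hΔ] at havg
  have hμ0 : 0 ≤ μ := hμ ▸ muP_nonneg hp.1 H
  have hΔ0 : 0 ≤ Δ := hΔ ▸ deltaP_nonneg hp.1 H
  set F := muP p S - deltaP p S with hF
  have hΛ0 : 0 ≤ Λ := by
    rw [hΛ]
    split_ifs
    · exact hμ0
    · exact le_min hμ0 (by positivity)
  have hΛF : Λ ≤ 4 * F := by
    have h1 := havg 1 ⟨zero_le_one, le_rfl⟩
    rcases le_or_gt (2 * Δ) μ with h | h
    · have : Λ ≤ μ := by
        rw [hΛ]
        split_ifs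
        · exact le_rfl
        · exact min_le_left _ _
      linarith
    · have hΔpos : 0 < Δ := by linarith
      have h2 := havg (μ / (2 * Δ)) ⟨by positivity, (div_le_one (by positivity)).2 h.le⟩
      have h3 : Λ ≤ μ ^ 2 / Δ := by
        rw [hΛ, if_neg hΔpos.ne']
        exact min_le_right _ _
      have h4 : μ / (2 * Δ) * μ - (μ / (2 * Δ)) ^ 2 * Δ = μ ^ 2 / Δ / 4 := by
        field_simp
        ring
      linarith
  refine (pBern_matchNum_le hp hSH hS (Λ / 1000)).trans
    (ENNReal.ofReal_le_ofReal (Real.exp_le_exp.2 ?_))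
  have h5 : Real.exp (-5) ≤ 1 / 6 := by
    rw [Real.exp_neg, inv_eq_one_div]
    exact one_div_le_one_div_of_le (by norm_num) (by linarith [Real.add_one_le_exp (5 : ℝ)])
  have h6 := mul_le_mul_of_nonneg_right h5 (muP_nonneg hp.1 S)
  linarith [two_mul_deltaP_le_muP hS]
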